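/- arXiv:1012.4728 — 3 statements merged into one kernel-verified Lean document; each statement's English description precedes it below -/
import Mathlib

section
/- Let k be a positive integer, ε ≥ 0, and let u_1, …, u_k be unit vectors in ℂ^k such that (1/k)·∑_{i≠j} |⟨u_i, u_j⟩|² ≤ ε. Then there exist pairwise orthogonal unit vectors v_1, …, v_k in ℂ^k such that (1/k)·∑_{i=1}^k ‖u_i − v_i‖² ≤ ε. -/
/-- The sum of `‖T eᵢ‖²` over an orthonormal basis does not depend on the basis. -/
theorem LinearMap.sum_norm_sq_apply_orthonormalBasis_eq
    {𝕜 E ι κ : Type*} [RCLike 𝕜] [NormedAddCommGroup E] [InnerProductSpace 𝕜 E]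
    [FiniteDimensional 𝕜 E] [Fintype ι] [Fintype κ] (T : E →ₗ[𝕜] E)
    (b : OrthonormalBasis ι 𝕜 E) (c : OrthonormalBasis κ 𝕜 E) :
    ∑ i, ‖T (b i)‖ ^ 2 = ∑ j, ‖T (c j)‖ ^ 2 := by
  have key : (∑ i, inner 𝕜 (b i) ((T.adjoint * T) (b i))) =
      ∑ j, inner 𝕜 (c j) ((T.adjoint * T) (c j)) := by
    rw [← LinearMap.trace_eq_sum_inner, ← LinearMap.trace_eq_sum_inner]
  simp only [Module.End.mul_apply, LinearMap.adjoint_inner_right,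
    inner_self_eq_norm_sq_to_K] at key
  exact_mod_cast key

/-- Pairwise orthogonal vectors indexed by the dimension are nonnegative multiples of an
orthonormal basis. -/
theorem OrthonormalBasis.exists_eq_norm_smul_of_pairwise_orthogonal
    {𝕜 E ι : Type*} [RCLike 𝕜] [NormedAddCommGroup E] [InnerProductSpace 𝕜 E]
    [FiniteDimensional 𝕜 E] [Fintype ι] (hι : Module.finrank 𝕜 E = Fintype.card ι)
    {x : ι → E} (hx : Pairwise fun i j => inner 𝕜 (x i) (x j) = 0) :
    ∃ b : OrthonormalBasis ι 𝕜 E, ∀ i, x i = (‖x i‖ : 𝕜) • b i := by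
  have ho : Orthonormal 𝕜
      (({i | x i ≠ 0} : Set ι).domRestrict fun i => ((‖x i‖⁻¹ : ℝ) : 𝕜) • x i) := by
    refine ⟨fun i => ?_, fun i j hij => ?_⟩
    · have hi : ‖x i‖ ≠ 0 := norm_ne_zero_iff.mpr i.2
      simp [Set.domRestrict_apply, norm_smul, hi]
    · simp [Set.domRestrict_apply, inner_smul_left, inner_smul_right,
        hx (Subtype.coe_injective.ne hij)]
  obtain ⟨b, hb⟩ := ho.exists_orthonormalBasis_extension_of_card_eq hι
  refine ⟨b, fun i => ?_⟩
  by_cases hi : x i = 0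
  · simp [hi]
  · have hi' : (‖x i‖ : 𝕜) ≠ 0 := by simpa using hi
    rw [hb i hi, smul_smul, RCLike.ofReal_inv, mul_inv_cancel₀ hi', one_smul]

/-- Every endomorphism `T` of a finite-dimensional inner product space is at least as close, in
Hilbert–Schmidt norm, to some isometry as `T† T` is to the identity. -/
theorem LinearMap.exists_linearIsometryEquiv_sum_norm_sub_sq_le
    {𝕜 E ι : Type*} [RCLike 𝕜] [NormedAddCommGroup E] [InnerProductSpace 𝕜 E]
    [FiniteDimensional 𝕜 E] [Fintype ι] (T : E →ₗ[𝕜] E) (e : OrthonormalBasis ι 𝕜 E) :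
    ∃ V : E ≃ₗᵢ[𝕜] E,
      ∑ i, ‖T (e i) - V (e i)‖ ^ 2 ≤ ∑ i, ‖T.adjoint (T (e i)) - e i‖ ^ 2 := by
  have hT := T.isSymmetric_adjoint_mul_self
  set w := hT.eigenvectorBasis rfl
  set l := hT.eigenvalues rfl
  have hTw : ∀ j, T.adjoint (T (w j)) = (l j : 𝕜) • w j := hT.apply_eigenvectorBasis rfl
  have hinner : ∀ i j, inner 𝕜 (T (w i)) (T (w j)) = (l j : 𝕜) * inner 𝕜 (w i) (w j) := by
    intro i j
    rw [← LinearMap.adjoint_inner_right, hTw, inner_smul_right]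
  have hlw : ∀ j, l j = ‖T (w j)‖ ^ 2 := by
    intro j
    have h := hinner j j
    rw [inner_self_eq_norm_sq_to_K, inner_self_eq_norm_sq_to_K, w.norm_eq_one] at h
    simp only [RCLike.ofReal_one, one_pow, mul_one] at h
    exact_mod_cast h.symm
  obtain ⟨b, hb⟩ := OrthonormalBasis.exists_eq_norm_smul_of_pairwise_orthogonal
    (𝕜 := 𝕜) (x := fun j => T (w j)) (by simp)
    (fun i j hij => by simp [hinner, w.inner_eq_zero hij])
  let V := w.equiv b (Equiv.refl _)
  have hV : ∀ j, V (w j) = b j := fun j => by simp [V]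
  refine ⟨V, ?_⟩
  have h₁ := (T - V.toLinearEquiv.toLinearMap).sum_norm_sq_apply_orthonormalBasis_eq e w
  have h₂ := (T.adjoint * T - 1).sum_norm_sq_apply_orthonormalBasis_eq e w
  simp only [LinearMap.sub_apply, Module.End.mul_apply, Module.End.one_apply,
    LinearEquiv.coe_coe, LinearIsometryEquiv.coe_toLinearEquiv] at h₁ h₂
  rw [h₁, h₂]
  refine Finset.sum_le_sum fun j _ => ?_
  have hL : T (w j) - V (w j) = ((‖T (w j)‖ - 1 : ℝ) : 𝕜) • b j := by
    rw [hV, RCLike.ofReal_sub, RCLike.ofReal_one, sub_smul, one_smul, ← hb j]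
  have hR : T.adjoint (T (w j)) - w j = ((‖T (w j)‖ ^ 2 - 1 : ℝ) : 𝕜) • w j := by
    rw [hTw, hlw, RCLike.ofReal_sub, RCLike.ofReal_one, sub_smul, one_smul]
  rw [hL, hR, norm_smul, norm_smul, b.norm_eq_one, w.norm_eq_one, RCLike.norm_ofReal,
    RCLike.norm_ofReal, mul_one, mul_one, sq_abs, sq_abs]
  nlinarith [norm_nonneg (T (w j)), mul_nonneg (sq_nonneg (‖T (w j)‖ - 1))
    (mul_nonneg (norm_nonneg (T (w j))) (add_nonneg (norm_nonneg (T (w j))) zero_le_two))]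

/-- Claim 5.1: almost-orthogonal unit vectors in ℂ^k are close in the mean-square
sense to an orthonormal family. -/
theorem almost_orthogonal_vectors (k : ℕ) (hk : 0 < k) (ε : ℝ) (hε : 0 ≤ ε)
    (u : Fin k → EuclideanSpace ℂ (Fin k))
    (hu : ∀ i, ‖u i‖ = 1)
    (h : (k : ℝ)⁻¹ * ∑ i : Fin k, ∑ j ∈ Finset.univ.erase i,
        ‖(inner ℂ (u i) (u j) : ℂ)‖ ^ 2 ≤ ε) :
    ∃ v : Fin k → EuclideanSpace ℂ (Fin k),
      (∀ i, ‖v i‖ = 1) ∧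
      (∀ i j, i ≠ j → (inner ℂ (v i) (v j) : ℂ) = 0) ∧
      (k : ℝ)⁻¹ * ∑ i : Fin k, ‖u i - v i‖ ^ 2 ≤ ε := by
  let e := EuclideanSpace.basisFun (Fin k) ℂ
  let T : EuclideanSpace ℂ (Fin k) →ₗ[ℂ] EuclideanSpace ℂ (Fin k) := e.toBasis.constr ℂ u
  have hT : ∀ i, T (e i) = u i := fun i => by
    rw [← e.coe_toBasis]
    exact e.toBasis.constr_basis ℂ u i
  obtain ⟨V, hV⟩ := T.exists_linearIsometryEquiv_sum_norm_sub_sq_le e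
  refine ⟨fun i => V (e i), fun i => by rw [V.norm_map, e.norm_eq_one], fun i j hij => by
    rw [V.inner_map_map, e.inner_eq_zero hij], le_trans ?_ h⟩
  simp only [hT] at hV
  refine mul_le_mul_of_nonneg_left (hV.trans_eq ?_) (by positivity)
  refine Finset.sum_congr rfl fun i _ => ?_
  rw [← e.sum_sq_norm_inner_right, ← Finset.add_sum_erase _ _ (Finset.mem_univ i)]
  have hcoef : ∀ j, inner ℂ (e j) (T.adjoint (u i) - e i) =
      inner ℂ (u j) (u i) - inner ℂ (e j) (e i) := fun j => by
    rw [inner_sub_right, LinearMap.adjoint_inner_right, hT]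
  have hii : inner ℂ (e i) (T.adjoint (u i) - e i) = 0 := by
    rw [hcoef, inner_self_eq_norm_sq_to_K, inner_self_eq_norm_sq_to_K, hu, e.norm_eq_one, sub_self]
  rw [hii, norm_zero, zero_pow two_ne_zero, zero_add]
  refine Finset.sum_congr rfl fun j hj => ?_
  rw [hcoef, e.inner_eq_zero (Finset.ne_of_mem_erase hj), sub_zero, norm_inner_symm]
end

section
/- Let A and ρ be n×n positive semidefinite complex matrices and let Π be an n×n orthogonal projection. Set a := Tr(Aρ) and b := |Tr((I−Π)AΠρ)|. Then Tr(ΠAΠρ) ≤ ((√a + √(a + 4b))/2)² ≤ a + 2b. -/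
open Matrix
open scoped ComplexOrder

open scoped MatrixOrder in
/-- The trace of the product of a congruence transform of a positive semidefinite matrix with
another positive semidefinite matrix is nonnegative. -/
lemma Matrix.PosSemidef.trace_conjTranspose_mul_mul_mul_nonneg {n : Type*} [Fintype n]
    {A ρ : Matrix n n ℂ} (hA : A.PosSemidef) (hρ : ρ.PosSemidef) (M : Matrix n n ℂ) :
    0 ≤ (Mᴴ * A * M * ρ).trace := by
  classical
  obtain ⟨B, rfl⟩ := CStarAlgebra.nonneg_iff_eq_star_mul_self.mp hρ.nonneg
  have h := (hA.conjTranspose_mul_mul_same (M * Bᴴ)).trace_nonneg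
  rw [star_eq_conjTranspose, ← Matrix.mul_assoc, Matrix.trace_mul_comm]
  simpa [Matrix.mul_assoc] using h

/-- Cauchy–Schwarz for the semi-inner product `⟪X, Y⟫ = Tr(Xᴴ A Y ρ)`, with `X = 1`. -/
lemma Matrix.PosSemidef.re_trace_mul_mul_sq_le {n : Type*} [Fintype n]
    {A ρ : Matrix n n ℂ} (hA : A.PosSemidef) (hρ : ρ.PosSemidef) (M : Matrix n n ℂ) :
    (A * M * ρ).trace.re ^ 2 ≤ (A * ρ).trace.re * (Mᴴ * A * M * ρ).trace.re := by
  classical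
  have hconj : (Mᴴ * A * ρ).trace.re = (A * M * ρ).trace.re := by
    have h : (Mᴴ * A * ρ).trace = star (A * M * ρ).trace := by
      rw [← Matrix.trace_conjTranspose, Matrix.conjTranspose_mul, Matrix.conjTranspose_mul,
        hA.isHermitian.eq, hρ.isHermitian.eq, Matrix.trace_mul_comm]
    rw [h]
    simp
  have hquad (t : ℝ) : 0 ≤ (A * ρ).trace.re * (t * t) + 2 * (A * M * ρ).trace.re * t +
      (Mᴴ * A * M * ρ).trace.re := by
    have h := (Complex.le_def.mp
      (hA.trace_conjTranspose_mul_mul_mul_nonneg hρ ((t : ℂ) • 1 + M))).1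
    simp only [Matrix.conjTranspose_add, Matrix.conjTranspose_smul, Matrix.conjTranspose_one,
      Matrix.add_mul, Matrix.mul_add, Matrix.smul_mul, Matrix.mul_smul, Matrix.one_mul,
      Matrix.mul_one, Matrix.trace_add, Matrix.trace_smul, smul_eq_mul, Complex.add_re,
      Complex.star_def, Complex.conj_ofReal, Complex.re_ofReal_mul, Complex.zero_re, hconj] at h
    linarith
  have h := discrim_le_zero hquad
  rw [discrim] at h
  linarith

/-- A nonnegative `x` with `x ≤ u + b` and `u² ≤ a x` is at most the square of the larger root of
`t² - √a t - b`. -/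
lemma le_sq_sqrt_add_sqrt_div_two {a b x u : ℝ} (ha : 0 ≤ a) (hx : 0 ≤ x)
    (hxu : x ≤ u + b) (hu : u ^ 2 ≤ a * x) : x ≤ ((√a + √(a + 4 * b)) / 2) ^ 2 := by
  have hu' : u ≤ √a * √x := by
    rw [← Real.sqrt_mul ha]
    exact Real.le_sqrt_of_sq_le hu
  have hle : 2 * √x - √a ≤ √(a + 4 * b) := by
    apply Real.le_sqrt_of_sq_le
    nlinarith [Real.sq_sqrt ha, Real.sq_sqrt hx]
  calc x = √x ^ 2 := (Real.sq_sqrt hx).symm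
    _ ≤ ((√a + √(a + 4 * b)) / 2) ^ 2 :=
      pow_le_pow_left₀ (Real.sqrt_nonneg x) (by linarith) 2

lemma sq_sqrt_add_sqrt_div_two_le {a b : ℝ} (ha : 0 ≤ a) (hb : 0 ≤ b) :
    ((√a + √(a + 4 * b)) / 2) ^ 2 ≤ a + 2 * b := by
  nlinarith [Real.sq_sqrt ha, Real.sq_sqrt (show 0 ≤ a + 4 * b by positivity),
    sq_nonneg (√a - √(a + 4 * b))]


/-- Second inequality of Fact `posblocks`: for `A, ρ ⪰ 0` and an orthogonal projection `Π`,
writing `a = Tr(Aρ)` (a nonnegative real) and `b = |Tr((I−Π)AΠρ)|`,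
we have `Tr(ΠAΠρ) ≤ ((√a + √(a + 4b))/2)² ≤ a + 2b`. -/
theorem posblocks_second (n : ℕ) (A ρ Pm : Matrix (Fin n) (Fin n) ℂ)
    (hA : A.PosSemidef) (hρ : ρ.PosSemidef)
    (hPm : Pm.IsHermitian) (hPm2 : Pm * Pm = Pm) :
    (Pm * A * Pm * ρ).trace ≤
      ((((Real.sqrt ((A * ρ).trace.re) +
          Real.sqrt ((A * ρ).trace.re +
            4 * ‖((1 - Pm) * A * Pm * ρ).trace‖)) / 2) ^ 2 : ℝ) : ℂ) ∧
    ((Real.sqrt ((A * ρ).trace.re) +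
        Real.sqrt ((A * ρ).trace.re +
          4 * ‖((1 - Pm) * A * Pm * ρ).trace‖)) / 2) ^ 2 ≤
      (A * ρ).trace.re + 2 * ‖((1 - Pm) * A * Pm * ρ).trace‖ := by
  have ha : 0 ≤ (A * ρ).trace.re := by
    simpa using (Complex.le_def.mp (hA.trace_conjTranspose_mul_mul_mul_nonneg hρ 1)).1
  have hx := hA.trace_conjTranspose_mul_mul_mul_nonneg hρ Pm
  have hu := hA.re_trace_mul_mul_sq_le hρ Pm
  rw [hPm.eq] at hx hu
  obtain ⟨hxre, hxim⟩ := Complex.le_def.mp hx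
  refine ⟨Complex.le_def.mpr ⟨?_, by rw [Complex.ofReal_im, ← hxim, Complex.zero_im]⟩,
    sq_sqrt_add_sqrt_div_two_le ha (norm_nonneg _)⟩
  rw [Complex.ofReal_re]
  refine le_sq_sqrt_add_sqrt_div_two ha hxre ?_ hu
  have hz := (abs_le.mp (Complex.abs_re_le_norm ((1 - Pm) * A * Pm * ρ).trace)).1
  have hsub : ((1 - Pm) * A * Pm * ρ).trace.re =
      (A * Pm * ρ).trace.re - (Pm * A * Pm * ρ).trace.re := by
    simp [Matrix.sub_mul]
  linarith
end

section
/- Let Q be a nonempty finite set, μ a probability distribution on Q, C and d positive integers, and f : Q^C → M_d(ℂ) a matrix-valued function. Let M := E_{q∼μ^C}[f(q)], and for i ∈ {1,…,C} and q_i ∈ Q let M_{i,q_i} be the expectation of f(q) over q ∼ μ^C conditioned on coordinate i equaling q_i. Write tr(X) := (1/d)·Tr(X) for the normalized trace and ‖X‖² := (1/d)·Tr(XᴴX) for the normalized Frobenius norm, and assume E_{q∼μ^C}[‖f(q)‖²] ≤ 1. Then the probability, over i chosen uniformly in {1,…,C} and q_i ∼ μ, that |tr(M) − tr(M_{i,q_i})|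 ≥ C^{−1/3}, is at most C^{−1/3}. -/
open Matrix ComplexConjugate

theorem weight_mul_prod_update {Q ι : Type*} [Fintype ι] [DecidableEq ι]
    (w : Q → ℝ) (i : ι) (q : ι → Q) (x : Q) :
    w (q i) * ∏ j, w (Function.update q i x j) = w x * ∏ j, w (q j) := by
  rw [← Finset.mul_prod_erase _ _ (Finset.mem_univ i),
    ← Finset.mul_prod_erase Finset.univ (fun j => w (q j)) (Finset.mem_univ i),
    Finset.prod_congr rfl (g := fun j => w (q j))]
  · simp only [Function.update_self]
    ring
  · intro j hj
    rw [Function.update_of_ne (Finset.ne_of_mem_erase hj)]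

section ProductExpectation

variable {Q ι V : Type*} [Fintype Q] [Fintype ι] [DecidableEq ι] [AddCommGroup V] [Module ℝ V]

/-- The expectation of `F` under the `ι`-fold product of the weight function `w`. -/
noncomputable def prodExpect (w : Q → ℝ) (F : (ι → Q) → V) : V :=
  ∑ q : ι → Q, (∏ i, w (q i)) • F q

theorem sum_prod_weights {w : Q → ℝ} (hw1 : ∑ q, w q = 1) :
    ∑ q : ι → Q, ∏ i, w (q i) = 1 := by
  have h := Finset.prod_univ_sum (fun _ : ι => (Finset.univ : Finset Q)) (fun _ x => w x)
  rw [Fintype.piFinset_univ] at h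
  rw [← h]
  simp [hw1]

theorem prodExpect_const {w : Q → ℝ} (hw1 : ∑ q, w q = 1) (c : V) :
    prodExpect w (fun _ : ι → Q => c) = c := by
  rw [prodExpect, ← Finset.sum_smul, sum_prod_weights hw1, one_smul]

theorem prodExpect_sum {κ : Type*} (w : Q → ℝ) (s : Finset κ) (F : κ → (ι → Q) → V) :
    prodExpect w (fun q => ∑ k ∈ s, F k q) = ∑ k ∈ s, prodExpect w (F k) := by
  simp only [prodExpect, Finset.smul_sum]
  exact Finset.sum_comm

theorem prodExpect_mul_left (w : Q → ℝ) (c : ℂ) (F : (ι → Q) → ℂ) :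
    prodExpect w (fun q => c * F q) = c * prodExpect w F := by
  simp only [prodExpect, Finset.mul_sum, mul_smul_comm]

theorem map_prodExpect {W : Type*} [AddCommGroup W] [Module ℝ W] (w : Q → ℝ) (L : V →ₗ[ℝ] W)
    (F : (ι → Q) → V) : L (prodExpect w F) = prodExpect w (fun q => L (F q)) := by
  simp [prodExpect]

/-- Total expectation: resampling the coordinate `i` does not change the expectation. -/
theorem sum_prodExpect_update {w : Q → ℝ} (hw1 : ∑ q, w q = 1) (i : ι) (F : (ι → Q) → V) :
    ∑ x, w x • prodExpect w (fun q => F (Function.update q i x)) = prodExpect w F := by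
  have swap : ∑ p : Q × (ι → Q), (w p.1 * ∏ j, w (p.2 j)) • F (Function.update p.2 i p.1) =
      ∑ p : Q × (ι → Q), (w p.1 * ∏ j, w (p.2 j)) • F p.2 := by
    refine Finset.sum_nbij' (fun p => (p.2 i, Function.update p.2 i p.1))
      (fun p => (p.2 i, Function.update p.2 i p.1)) ?_ ?_ ?_ ?_ ?_
    · simp
    · simp
    · simp
    · simp
    · intro p _
      simp only [weight_mul_prod_update]
  simp only [Fintype.sum_prod_type, mul_smul, ← Finset.smul_sum] at swap
  simp only [prodExpect]
  rw [swap, ← Finset.sum_smul, hw1, one_smul]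

/-- The expectation of a function of one coordinate times `G`, via the conditional
expectations of `G`. -/
theorem prodExpect_coord_mul {w : Q → ℝ} (hw1 : ∑ q, w q = 1) (i : ι) (h : Q → ℂ)
    (G : (ι → Q) → ℂ) :
    prodExpect w (fun q => h (q i) * G q) =
      ∑ x, w x • (h x * prodExpect w (fun q => G (Function.update q i x))) := by
  rw [← sum_prodExpect_update hw1 i]
  simp only [Function.update_self, prodExpect_mul_left]

theorem prodExpect_coord {w : Q → ℝ} (hw1 : ∑ q, w q = 1) (i : ι) (h : Q → V) :
    prodExpect w (fun q : ι → Q => h (q i)) = ∑ x, w x • h x := by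
  rw [← sum_prodExpect_update hw1 i]
  simp only [Function.update_self, prodExpect_const hw1]

/-- Bessel's inequality for the projections of `g` on functions of a single coordinate. -/
theorem sum_sq_norm_condExpect_sub_le {w : Q → ℝ} (hw : ∀ q, 0 ≤ w q) (hw1 : ∑ q, w q = 1)
    (g : (ι → Q) → ℂ) :
    ∑ i, ∑ x, w x *
        ‖prodExpect w (fun q => g (Function.update q i x)) - prodExpect w g‖ ^ 2 ≤
      prodExpect w (fun q => ‖g q‖ ^ 2) := by
  set m := prodExpect w g with hm
  set h : ι → Q → ℂ := fun i x => prodExpect w (fun q => g (Function.update q i x)) - m with hh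
  set S : ℝ := ∑ i, ∑ x, w x * ‖h i x‖ ^ 2 with hS
  have centered (i : ι) : ∑ x, w x • h i x = 0 := by
    simp only [hh, smul_sub, Finset.sum_sub_distrib, ← Finset.sum_smul, hw1, one_smul,
      sum_prodExpect_update hw1, hm, sub_self]
  have condExpect_H (i : ι) (x : Q) :
      prodExpect w (fun q => ∑ j, h j (Function.update q i x j)) = h i x := by
    rw [prodExpect_sum, Finset.sum_eq_single i]
    · simp only [Function.update_self, prodExpect_const hw1]
    · intro j _ hj
      simp only [Function.update_of_ne hj, prodExpect_coord hw1, centered]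
    · simp
  have inner_eq (G : (ι → Q) → ℂ) (c : ℂ)
      (hG : ∀ i x, prodExpect w (fun q => G (Function.update q i x)) = h i x + c) :
      prodExpect w (fun q => conj (∑ i, h i (q i)) * G q) = (S : ℂ) := by
    simp only [map_sum, Finset.sum_mul]
    rw [prodExpect_sum, hS, Complex.ofReal_sum]
    refine Finset.sum_congr rfl fun i _ => ?_
    have conj_centered : ∑ x, w x • (conj (h i x) * c) = 0 := by
      have := congrArg conj (centered i)
      simp only [map_sum, Complex.real_smul, map_mul, Complex.conj_ofReal, map_zero] at this
      simp only [Complex.real_smul, ← mul_assoc, ← Finset.sum_mul, this, zero_mul]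
    rw [prodExpect_coord_mul hw1 i (fun x => conj (h i x)) G]
    simp only [hG, mul_add, smul_add, Finset.sum_add_distrib, conj_centered, add_zero]
    simp [Complex.conj_mul']
  have hg := inner_eq g m fun i x => by simp [hh]
  have hH := inner_eq (fun q => ∑ i, h i (q i)) 0 fun i x => by rw [condExpect_H, add_zero]
  have nonneg : 0 ≤ prodExpect w (fun q => ‖g q - ∑ i, h i (q i)‖ ^ 2) :=
    Finset.sum_nonneg fun q _ =>
      smul_nonneg (Finset.prod_nonneg fun i _ => hw _) (sq_nonneg _)
  have expand (H : (ι → Q) → ℂ) : prodExpect w (fun q => ‖g q - H q‖ ^ 2) =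
      prodExpect w (fun q => ‖g q‖ ^ 2) -
        2 * (prodExpect w (fun q => conj (H q) * g q)).re +
        (prodExpect w (fun q => conj (H q) * H q)).re := by
    simp only [prodExpect, Complex.re_sum, Finset.mul_sum, ← Finset.sum_sub_distrib,
      ← Finset.sum_add_distrib]
    refine Finset.sum_congr rfl fun q _ => ?_
    simp only [Complex.smul_re, smul_eq_mul, Complex.sq_norm, Complex.normSq_apply,
      Complex.sub_re, Complex.sub_im, Complex.mul_re, Complex.conj_re, Complex.conj_im]
    ring
  rw [expand, hg, hH, Complex.ofReal_re] at nonneg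
  linarith

end ProductExpectation

theorem sq_norm_normalized_trace_le {d : ℕ} (hd : 0 < d) (A : Matrix (Fin d) (Fin d) ℂ) :
    ‖(d : ℂ)⁻¹ * A.trace‖ ^ 2 ≤ (d : ℝ)⁻¹ * (Aᴴ * A).trace.re := by
  have hd' : (0 : ℝ) < d := by exact_mod_cast hd
  have trace_eq : (Aᴴ * A).trace.re = ∑ i, ∑ j, ‖A j i‖ ^ 2 := by
    simp [Matrix.trace, Matrix.mul_apply, Complex.conj_mul', ← Complex.ofReal_pow]
  have diag_le : ∑ i, ‖A i i‖ ^ 2 ≤ (Aᴴ * A).trace.re := by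
    rw [trace_eq]
    exact Finset.sum_le_sum fun i _ =>
      Finset.single_le_sum (f := fun j => ‖A j i‖ ^ 2) (fun j _ => sq_nonneg _)
        (Finset.mem_univ i)
  have trace_le : ‖A.trace‖ ^ 2 ≤ d * ∑ i, ‖A i i‖ ^ 2 := by
    calc ‖A.trace‖ ^ 2 ≤ (∑ i, ‖A i i‖) ^ 2 := by
          gcongr
          exact norm_sum_le _ _
      _ ≤ d * ∑ i, ‖A i i‖ ^ 2 := by
          simpa using sq_sum_le_card_mul_sum_sq (s := Finset.univ) (f := fun i => ‖A i i‖)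
  rw [norm_mul, norm_inv, Complex.norm_natCast, mul_pow]
  calc (d : ℝ)⁻¹ ^ 2 * ‖A.trace‖ ^ 2
      ≤ (d : ℝ)⁻¹ ^ 2 * (d * (Aᴴ * A).trace.re) := by
        gcongr
        exact trace_le.trans (by gcongr)
    _ = (d : ℝ)⁻¹ * (Aᴴ * A).trace.re := by field_simp

/-- The real-linear normalized trace. -/
noncomputable def normalizedTrace (d : ℕ) : Matrix (Fin d) (Fin d) ℂ →ₗ[ℝ] ℂ :=
  (LinearMap.mulLeft ℝ (d : ℂ)⁻¹).comp (Matrix.traceLinearMap (Fin d) ℝ ℂ)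

/-- Part 3 of Claim A.1, for matrix-valued `f` and the normalized trace
`tr(X) = Tr(X)/d` and normalized Frobenius norm `‖X‖² = Tr(XᴴX)/d`: if `E‖f‖² ≤ 1`
then the probability over `(i, q_i)` that `|tr(M) − tr(M_{i,q_i})| ≥ C^{−1/3}` is at
most `C^{−1/3}`. -/
theorem claimA1_part3 {Q : Type*} [Fintype Q] [Nonempty Q] [DecidableEq Q]
    (w : Q → ℝ) (hw : ∀ q, 0 ≤ w q) (hw1 : ∑ q, w q = 1)
    (C d : ℕ) (hC : 0 < C) (hd : 0 < d)
    (f : (Fin C → Q) → Matrix (Fin d) (Fin d) ℂ)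
    (hf : ∑ q : Fin C → Q, (∏ i, w (q i)) * ((d : ℝ)⁻¹ * ((f q)ᴴ * f q).trace.re) ≤ 1) :
    let M := ∑ q : Fin C → Q, (∏ i, w (q i)) • f q
    let Mi := fun (i : Fin C) (qi : Q) =>
      ∑ q : Fin C → Q, (∏ j, w (q j)) • f (Function.update q i qi)
    (C : ℝ)⁻¹ * ∑ i : Fin C, ∑ qi : Q,
        (if (C : ℝ) ^ (-(1/3 : ℝ)) ≤
            ‖(d : ℂ)⁻¹ * M.trace - (d : ℂ)⁻¹ * (Mi i qi).trace‖
         then w qi else 0)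
      ≤ (C : ℝ) ^ (-(1/3 : ℝ)) := by
  intro M Mi
  set t : ℝ := (C : ℝ) ^ (-(1/3 : ℝ)) with ht
  have hC' : (0 : ℝ) < C := by exact_mod_cast hC
  have t_pos : 0 < t := Real.rpow_pos_of_pos hC' _
  have t_cube : t ^ 3 = (C : ℝ)⁻¹ := by
    rw [ht, ← Real.rpow_natCast, ← Real.rpow_mul hC'.le]
    norm_num [Real.rpow_neg_one]
  set g : (Fin C → Q) → ℂ := fun q => normalizedTrace d (f q) with hg
  have trace_M : (d : ℂ)⁻¹ * M.trace = prodExpect w g :=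
    map_prodExpect w (normalizedTrace d) f
  have trace_Mi (i : Fin C) (x : Q) : (d : ℂ)⁻¹ * (Mi i x).trace =
      prodExpect w (fun q => g (Function.update q i x)) :=
    map_prodExpect w (normalizedTrace d) fun q => f (Function.update q i x)
  have g_le : prodExpect w (fun q => ‖g q‖ ^ 2) ≤ 1 :=
    (Finset.sum_le_sum fun q _ => mul_le_mul_of_nonneg_left
      (sq_norm_normalized_trace_le hd (f q)) (Finset.prod_nonneg fun i _ => hw _)).trans hf
  have markov : t ^ 2 * ∑ i : Fin C, ∑ x : Q,
      (if t ≤ ‖(d : ℂ)⁻¹ * M.trace - (d : ℂ)⁻¹ * (Mi i x).trace‖ then w x else 0) ≤ 1 := by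
    refine le_trans ?_ ((sum_sq_norm_condExpect_sub_le hw hw1 g).trans g_le)
    simp only [Finset.mul_sum, trace_M, trace_Mi]
    refine Finset.sum_le_sum fun i _ => Finset.sum_le_sum fun x _ => ?_
    split_ifs with h
    · rw [norm_sub_rev] at h
      rw [mul_comm]
      gcongr
      exact hw x
    · rw [mul_zero]
      exact mul_nonneg (hw x) (sq_nonneg _)
  rw [← t_cube, pow_succ', mul_assoc]
  exact mul_le_of_le_one_right t_pos.le markov
end
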